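/- Let G be a Garside group of finite type, x ∈ G, v ∈ SC(x), and let N be the smallest positive integer such that 𝔰^N(v) = v. Let s be a nontrivial positive element such that v^s ∈ SSS(x), and for integers k ≥ 0 consider the iterated pullbacks s_{(kN)} at v. If i ≥ 0 is such that s_{(iN)} = s_{(jN)} for some j > i, then c_s(v) is the unique element of F(s_{(iN)}) which admits s as a prefix; in particular, F(s_{(iN)}) ≠ {1}. -/

import Mathlib

/-- A Garside structure of finite type on a group `G`: a submonoid `P` of positive
elements with `P ∩ P⁻¹ = {1}`, such that the prefix order `a ⪯ b ↔ a⁻¹ * b ∈ P` is a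
lattice order (with meet `wedge` and join `vee`), together with a Garside element `Δ ∈ P`
whose set of prefixes (the simple elements) is finite and generates `G`, satisfying
`Δ⁻¹ P Δ = P`, and such that every nontrivial positive element has a finite norm. -/
structure GarsideStructure (G : Type*) [Group G] where
  P : Set G
  one_mem : (1 : G) ∈ P
  mul_mem : ∀ {a b : G}, a ∈ P → b ∈ P → a * b ∈ P
  eq_one_of_mem_of_inv_mem : ∀ a : G, a ∈ P → a⁻¹ ∈ P → a = 1
  wedge : G → G → G
  vee : G → G → G
  wedge_le_left : ∀ a b : G, (wedge a b)⁻¹ * a ∈ P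
  wedge_le_right : ∀ a b : G, (wedge a b)⁻¹ * b ∈ P
  le_wedge : ∀ a b c : G, c⁻¹ * a ∈ P → c⁻¹ * b ∈ P → c⁻¹ * wedge a b ∈ P
  le_vee_left : ∀ a b : G, a⁻¹ * vee a b ∈ P
  le_vee_right : ∀ a b : G, b⁻¹ * vee a b ∈ P
  vee_le : ∀ a b c : G, a⁻¹ * c ∈ P → b⁻¹ * c ∈ P → (vee a b)⁻¹ * c ∈ P
  Δ : G
  Δ_mem : Δ ∈ P
  simples_finite : {s : G | s ∈ P ∧ s⁻¹ * Δ ∈ P}.Finite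
  simples_generate : Subgroup.closure {s : G | s ∈ P ∧ s⁻¹ * Δ ∈ P} = (⊤ : Subgroup G)
  conj_Delta_mem : ∀ a : G, a ∈ P → Δ⁻¹ * a * Δ ∈ P
  mem_of_conj_Delta_mem : ∀ a : G, Δ⁻¹ * a * Δ ∈ P → a ∈ P
  norm_bounded : ∀ x : G, x ∈ P → x ≠ 1 →
    ∃ n : ℕ, ∀ L : List G, (∀ a ∈ L, a ∈ P ∧ a ≠ 1) → L.prod = x → L.length ≤ n

namespace GarsideStructure

variable {G : Type*} [Group G] (gs : GarsideStructure G)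

/-- The prefix order: `a ⪯ b`. -/
def pre (a b : G) : Prop := a⁻¹ * b ∈ gs.P

/-- The suffix order: `a ≽ b` (i.e. `b` is a suffix of `a`). -/
def rdvd (a b : G) : Prop := a * b⁻¹ ∈ gs.P

/-- Greatest common divisor with respect to the suffix order `≽` : `a ∧↰ b`. -/
def rwedge (a b : G) : G := (gs.vee a⁻¹ b⁻¹)⁻¹

/-- Least common multiple with respect to the suffix order `≽` : `a ∨↰ b`. -/
def rvee (a b : G) : G := (gs.wedge a⁻¹ b⁻¹)⁻¹

/-- Simple elements: positive prefixes of `Δ`. -/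
def simple (s : G) : Prop := s ∈ gs.P ∧ s⁻¹ * gs.Δ ∈ gs.P

/-- Atoms: nontrivial positive elements which cannot be decomposed in `P`. -/
def atom (a : G) : Prop := a ∈ gs.P ∧ a ≠ 1 ∧
  ∀ b c : G, b ∈ gs.P → c ∈ gs.P → a = b * c → b = 1 ∨ c = 1

/-- `inf x` : the maximal integer `p` with `Δ^p ⪯ x`. -/
noncomputable def ginf (x : G) : ℤ := sSup {p : ℤ | gs.pre (gs.Δ ^ p) x}

/-- `sup x` : the minimal integer `p` with `x ⪯ Δ^p`. -/
noncomputable def gsup (x : G) : ℤ := sInf {p : ℤ | gs.pre x (gs.Δ ^ p)}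

/-- Canonical length `ℓ(x) = sup(x) - inf(x)`. -/
noncomputable def glen (x : G) : ℤ := gs.gsup x - gs.ginf x

/-- `‖x‖` : the maximal number of factors in a decomposition of `x` as a product of
nontrivial positive elements. -/
noncomputable def gnorm (x : G) : ℕ :=
  sSup {k : ℕ | ∃ L : List G, (∀ a ∈ L, a ∈ gs.P ∧ a ≠ 1) ∧ L.prod = x ∧ L.length = k}

/-- The summit infimum `inf_s(x)` : the maximum of `inf` over the conjugacy class of `x`. -/
noncomputable def ginfs (x : G) : ℤ :=
  sSup {p : ℤ | ∃ y : G, (∃ α : G, α⁻¹ * x * α = y) ∧ p = gs.ginf y}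

/-- The summit supremum `sup_s(x)` : the minimum of `sup` over the conjugacy class of `x`. -/
noncomputable def gsups (x : G) : ℤ :=
  sInf {p : ℤ | ∃ y : G, (∃ α : G, α⁻¹ * x * α = y) ∧ p = gs.gsup y}

/-- The preferred prefix `𝔭(x) = (xΔ^{-inf x}) ∧ (x⁻¹Δ^{sup x}) ∧ Δ`. -/
noncomputable def pp (x : G) : G :=
  gs.wedge (gs.wedge (x * gs.Δ ^ (-gs.ginf x)) (x⁻¹ * gs.Δ ^ gs.gsup x)) gs.Δ

/-- Cyclic (left) sliding `𝔰(x) = 𝔭(x)⁻¹ x 𝔭(x)`. -/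
noncomputable def sl (x : G) : G := (gs.pp x)⁻¹ * x * gs.pp x

/-- The preferred suffix `𝔭↰(x) = (Δ^{-inf x}x) ∧↰ (Δ^{sup x}x⁻¹) ∧↰ Δ`. -/
noncomputable def ps (x : G) : G :=
  gs.rwedge (gs.rwedge (gs.Δ ^ (-gs.ginf x) * x) (gs.Δ ^ gs.gsup x * x⁻¹)) gs.Δ

/-- Cyclic right sliding `𝔰↰(x) = 𝔭↰(x) x 𝔭↰(x)⁻¹`. -/
noncomputable def rsl (x : G) : G := gs.ps x * x * (gs.ps x)⁻¹

/-- The super summit set `SSS(x)` : conjugates of `x` with maximal infimum and minimal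
supremum among all conjugates of `x`. -/
def SSS (x : G) : Set G :=
  {y | (∃ α : G, α⁻¹ * x * α = y) ∧
    ∀ z : G, (∃ α : G, α⁻¹ * x * α = z) → gs.ginf z ≤ gs.ginf y ∧ gs.gsup y ≤ gs.gsup z}

/-- The set of sliding circuits `SC(x)` : conjugates `y` of `x` with `𝔰^m(y) = y` for
some `m ≥ 1`. -/
noncomputable def SC (x : G) : Set G :=
  {y | (∃ α : G, α⁻¹ * x * α = y) ∧ ∃ m : ℕ, 1 ≤ m ∧ (gs.sl)^[m] y = y}

/-- The transport `α^{(1)} = 𝔭(x)⁻¹ α 𝔭(x^α)` of `α` at `x`. -/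
noncomputable def transport (x α : G) : G := (gs.pp x)⁻¹ * α * gs.pp (α⁻¹ * x * α)

/-- Iterated transport `α^{(i)}` of `α` at `x`: `α^{(0)} = α` and `α^{(i+1)}` is the
transport of `α^{(i)}` at `𝔰^i(x)`. -/
noncomputable def transportIter (x α : G) : ℕ → G
  | 0 => α
  | i + 1 => gs.transport ((gs.sl)^[i] x) (transportIter x α i)

/-- `c` is the `⪯`-minimal element `c_s(y)` satisfying `s ⪯ c` and `y^c ∈ SC(x)`. -/
def IsMinSCConj (x y s c : G) : Prop :=
  gs.pre s c ∧ (c⁻¹ * y * c) ∈ gs.SC x ∧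
    ∀ d : G, gs.pre s d → (d⁻¹ * y * d) ∈ gs.SC x → gs.pre c d

/-- `s` is an indecomposable conjugator starting at `u`: `u^s ∈ SC(x)`, `s ≠ 1` and there
is no `t` with `1 ≺ t ≺ s` and `u^t ∈ SC(x)`. -/
def IsIndecomposableConjugator (x u s : G) : Prop :=
  (s⁻¹ * u * s) ∈ gs.SC x ∧ s ≠ 1 ∧
    ¬ ∃ t : G, (gs.pre 1 t ∧ t ≠ 1) ∧ (gs.pre t s ∧ t ≠ s) ∧ (t⁻¹ * u * t) ∈ gs.SC x

/-- `u` is the pullback of `s` at `y = 𝔰(z)` : the `⪯`-minimal positive element with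
`z^u ∈ SSS(x)` and `s ⪯ u^{(1)}` (transport at `z`). -/
def IsPullback (x z s u : G) : Prop :=
  u ∈ gs.P ∧ (u⁻¹ * z * u) ∈ gs.SSS x ∧ gs.pre s (gs.transport z u) ∧
    ∀ u' : G, u' ∈ gs.P → (u'⁻¹ * z * u') ∈ gs.SSS x → gs.pre s (gs.transport z u') →
      gs.pre u u'

/-- The pullback `s_{(1)}` of `s` at `y = 𝔰(z)`. -/
noncomputable def pullbackOne (x z s : G) : G :=
  @Classical.epsilon G ⟨1⟩ (fun u => gs.IsPullback x z s u)

/-- The `k`-fold pullback `s_{(k)}` of `s` at `y = 𝔰^k(z)` (an element at `z`):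
`s_{(0)} = s` and `s_{(k+1)}` is the pullback at `𝔰(z)` (relative to `z`) of the `k`-fold
pullback of `s` at `𝔰^k(𝔰(z)) = y`. -/
noncomputable def pullbackIter (x : G) : G → ℕ → G → G
  | _, 0, s => s
  | z, k + 1, s => gs.pullbackOne x z (pullbackIter x (gs.sl z) k s)

end GarsideStructure

open GarsideStructure

variable {G : Type*} [Group G]

namespace GarsideStructure

variable (gs : GarsideStructure G)

theorem pre_refl (a : G) : gs.pre a a := by
  simpa [pre] using gs.one_mem

variable {gs}

theorem pre.trans {a b c : G} (h : gs.pre a b) (h' : gs.pre b c) : gs.pre a c := by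
  have := gs.mul_mem h h'
  simpa [pre, mul_assoc] using this

theorem pre.antisymm {a b : G} (h : gs.pre a b) (h' : gs.pre b a) : a = b := by
  have := gs.eq_one_of_mem_of_inv_mem (a⁻¹ * b) h (by simpa [pre] using h')
  exact (inv_mul_eq_one.mp this)

theorem pre_mul_left_iff (g : G) {a b : G} : gs.pre (g * a) (g * b) ↔ gs.pre a b := by
  simp [pre, mul_assoc]

theorem pre_one_iff {a : G} : gs.pre 1 a ↔ a ∈ gs.P := by
  simp [pre]

theorem conj_zpow_mem_iff (k : ℤ) (a : G) :
    (gs.Δ ^ k)⁻¹ * a * gs.Δ ^ k ∈ gs.P ↔ a ∈ gs.P := by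
  have step (b : G) : gs.Δ⁻¹ * b * gs.Δ ∈ gs.P ↔ b ∈ gs.P :=
    ⟨gs.mem_of_conj_Delta_mem b, gs.conj_Delta_mem b⟩
  induction k using Int.induction_on with
  | zero => simp
  | succ n ih =>
    refine Iff.trans ?_ ((step _).trans ih)
    simp only [zpow_add_one, mul_assoc, mul_inv_rev]
  | pred n ih =>
    refine Iff.trans (step _).symm (Iff.trans ?_ ih)
    simp only [zpow_sub_one, mul_assoc, mul_inv_rev, inv_inv, inv_mul_cancel, mul_one,
      inv_mul_cancel_left]

theorem pre_mul_zpow_iff (k : ℤ) {a b : G} :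
    gs.pre (a * gs.Δ ^ k) (b * gs.Δ ^ k) ↔ gs.pre a b := by
  unfold pre
  rw [← conj_zpow_mem_iff k (a⁻¹ * b)]
  simp only [mul_assoc, mul_inv_rev]

theorem pre_mul_Delta_iff {a b : G} : gs.pre (a * gs.Δ) (b * gs.Δ) ↔ gs.pre a b := by
  simpa using pre_mul_zpow_iff (gs := gs) 1 (a := a) (b := b)

theorem zpow_pre_zpow {k l : ℤ} (h : k ≤ l) : gs.pre (gs.Δ ^ k) (gs.Δ ^ l) := by
  obtain ⟨n, rfl⟩ := Int.le.dest h
  unfold pre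
  rw [zpow_add, inv_mul_cancel_left, zpow_natCast]
  induction n with
  | zero => simpa using gs.one_mem
  | succ n ih => rw [pow_succ]; exact gs.mul_mem (ih (by lia)) gs.Δ_mem

theorem mul_zpow_pre_mul_zpow (a : G) {k l : ℤ} (h : k ≤ l) :
    gs.pre (a * gs.Δ ^ k) (a * gs.Δ ^ l) :=
  (pre_mul_left_iff a).mpr (zpow_pre_zpow h)

theorem pre_wedge_iff {a b c : G} : gs.pre c (gs.wedge a b) ↔ gs.pre c a ∧ gs.pre c b :=
  ⟨fun h => ⟨h.trans (gs.wedge_le_left a b), h.trans (gs.wedge_le_right a b)⟩,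
    fun h => gs.le_wedge a b c h.1 h.2⟩

theorem wedge_pre_left (a b : G) : gs.pre (gs.wedge a b) a := gs.wedge_le_left a b

theorem wedge_pre_right (a b : G) : gs.pre (gs.wedge a b) b := gs.wedge_le_right a b

theorem eq_of_forall_pre_iff {a b : G} (h : ∀ c, gs.pre c a ↔ gs.pre c b) : a = b :=
  pre.antisymm ((h a).mp (pre_refl gs a)) ((h b).mpr (pre_refl gs b))

theorem pre_mul_iff_inv_mul_pre (g : G) {a b : G} :
    gs.pre a (g * b) ↔ gs.pre (g⁻¹ * a) b := by
  rw [← pre_mul_left_iff g (a := g⁻¹ * a), mul_inv_cancel_left]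

theorem pre_mul_left_iff_inv (g : G) {a b : G} : gs.pre (g * a) b ↔ gs.pre a (g⁻¹ * b) := by
  rw [← pre_mul_left_iff g (b := g⁻¹ * b), mul_inv_cancel_left]

theorem pre_mul_zpow_iff_mul_zpow_neg_pre (k : ℤ) {a b : G} :
    gs.pre a (b * gs.Δ ^ k) ↔ gs.pre (a * gs.Δ ^ (-k)) b := by
  rw [← pre_mul_zpow_iff k (a := a * gs.Δ ^ (-k))]
  simp

theorem mul_wedge (g a b : G) : g * gs.wedge a b = gs.wedge (g * a) (g * b) :=
  eq_of_forall_pre_iff (gs := gs) fun c => by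
    simp only [pre_wedge_iff, pre_mul_iff_inv_mul_pre]

theorem wedge_mul_zpow (k : ℤ) (a b : G) :
    gs.wedge a b * gs.Δ ^ k = gs.wedge (a * gs.Δ ^ k) (b * gs.Δ ^ k) :=
  eq_of_forall_pre_iff (gs := gs) fun c => by
    simp only [pre_wedge_iff, pre_mul_zpow_iff_mul_zpow_neg_pre]

theorem wedge_eq_left_iff {a b : G} : gs.wedge a b = a ↔ gs.pre a b :=
  ⟨fun h => h ▸ wedge_pre_right a b, fun h =>
    (wedge_pre_left a b).antisymm (pre_wedge_iff.mpr ⟨pre_refl gs a, h⟩)⟩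

theorem wedge_eq_right_iff {a b : G} : gs.wedge a b = b ↔ gs.pre b a :=
  ⟨fun h => h ▸ wedge_pre_left a b, fun h =>
    (wedge_pre_right a b).antisymm (pre_wedge_iff.mpr ⟨h, pre_refl gs b⟩)⟩

theorem wedge_comm (a b : G) : gs.wedge a b = gs.wedge b a :=
  eq_of_forall_pre_iff (gs := gs) fun c => by simp only [pre_wedge_iff, and_comm]

/-! ### Boundedness and finiteness of intervals -/

variable (gs) in
theorem exists_zpow_neg_pre_pre_zpow (x : G) :
    ∃ n : ℕ, gs.pre (gs.Δ ^ (-n : ℤ)) x ∧ gs.pre x (gs.Δ ^ (n : ℤ)) := by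
  have hx : x ∈ Subgroup.closure {s : G | s ∈ gs.P ∧ s⁻¹ * gs.Δ ∈ gs.P} := by
    rw [gs.simples_generate]; trivial
  induction hx using Subgroup.closure_induction with
  | mem s hs =>
    refine ⟨1, ?_, by simpa [pre] using hs.2⟩
    simpa [pre] using gs.mul_mem gs.Δ_mem hs.1
  | one => exact ⟨0, by simpa using pre_refl gs 1⟩
  | mul x y _ _ hx hy =>
    obtain ⟨n, hn, hn'⟩ := hx
    obtain ⟨m, hm, hm'⟩ := hy
    refine ⟨n + m, ?_, ?_⟩
    · have h1 := (pre_mul_zpow_iff (-m : ℤ)).mpr hn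
      have h2 := (pre_mul_left_iff x).mpr hm
      rw [← zpow_add] at h1
      simpa [neg_add, add_comm] using h1.trans h2
    · have h1 := (pre_mul_zpow_iff (m : ℤ)).mpr hn'
      have h2 := (pre_mul_left_iff x).mpr hm'
      rw [← zpow_add] at h1
      simpa using h2.trans h1
  | inv x _ hx =>
    obtain ⟨n, hn, hn'⟩ := hx
    refine ⟨n, ?_, ?_⟩
    · have h1 := (pre_mul_zpow_iff (-n : ℤ)).mpr ((pre_mul_left_iff x⁻¹).mpr hn')
      simpa using h1
    · have h1 := (pre_mul_zpow_iff (n : ℤ)).mpr ((pre_mul_left_iff x⁻¹).mpr hn)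
      simpa using h1

variable (gs) in
theorem finite_setOf_pre_zpow (n : ℕ) :
    {u : G | gs.pre 1 u ∧ gs.pre u (gs.Δ ^ (n : ℤ))}.Finite := by
  induction n with
  | zero =>
    refine (Set.finite_singleton (1 : G)).subset ?_
    rintro u ⟨h, h'⟩
    exact (h.antisymm (by simpa using h')).symm
  | succ n ih =>
    refine (gs.simples_finite.image2 (fun a b => a * b) ih).subset ?_
    rintro u ⟨h, h'⟩
    have h1 : gs.pre 1 gs.Δ := pre_one_iff.mpr gs.Δ_mem
    refine ⟨gs.wedge u gs.Δ, ⟨pre_one_iff.mp (pre_wedge_iff.mpr ⟨h, h1⟩),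
      gs.wedge_le_right _ _⟩, (gs.wedge u gs.Δ)⁻¹ * u, ⟨?_, ?_⟩, by simp⟩
    · simpa [pre] using gs.wedge_le_left u gs.Δ
    · rw [← pre_mul_left_iff (gs.wedge u gs.Δ), mul_inv_cancel_left, wedge_mul_zpow,
        pre_wedge_iff]
      constructor
      · simpa using mul_zpow_pre_mul_zpow (gs := gs) u (k := 0) (l := n) (by lia)
      · rw [← zpow_one_add, add_comm]; exact_mod_cast h'

variable (gs) in
theorem finite_Icc (a b : G) : {u : G | gs.pre a u ∧ gs.pre u b}.Finite := by
  obtain ⟨n, -, hn⟩ := gs.exists_zpow_neg_pre_pre_zpow (a⁻¹ * b)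
  refine ((gs.finite_setOf_pre_zpow n).image (a * ·)).subset ?_
  rintro u ⟨h, h'⟩
  refine ⟨a⁻¹ * u, ⟨?_, ?_⟩, by simp⟩
  · simpa [pre] using h
  · exact ((pre_mul_left_iff a⁻¹).mpr h').trans hn

theorem exists_lt_eq_of_mem_Icc {a b : G} {f : ℕ → G} (ha : ∀ n, gs.pre a (f n))
    (hb : ∀ n, gs.pre (f n) b) : ∃ m n, m < n ∧ f m = f n := by
  obtain ⟨m, -, n, -, h, h'⟩ := Set.infinite_univ.exists_lt_map_eq_of_mapsTo (f := f)
    (fun n _ => (⟨ha n, hb n⟩ : f n ∈ {u : G | gs.pre a u ∧ gs.pre u b})) (gs.finite_Icc a b)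
  exact ⟨m, n, h, h'⟩

theorem pre_of_le_of_step {f : ℕ → G} (hf : ∀ n, gs.pre (f n) (f (n + 1))) {m n : ℕ}
    (h : m ≤ n) : gs.pre (f m) (f n) := by
  induction n, h using Nat.le_induction with
  | base => exact pre_refl gs _
  | succ n _ ih => exact ih.trans (hf n)

theorem pre_of_le_of_step_down {f : ℕ → G} (hf : ∀ n, gs.pre (f (n + 1)) (f n)) {m n : ℕ}
    (h : m ≤ n) : gs.pre (f n) (f m) := by
  induction n, h using Nat.le_induction with
  | base => exact pre_refl gs _
  | succ n _ ih => exact (hf n).trans ih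

theorem exists_eq_succ_of_increasing {b : G} {f : ℕ → G}
    (hf : ∀ n, gs.pre (f n) (f (n + 1))) (hb : ∀ n, gs.pre (f n) b) :
    ∃ n, f (n + 1) = f n := by
  obtain ⟨m, n, hmn, h⟩ :=
    exists_lt_eq_of_mem_Icc (fun n => pre_of_le_of_step hf (Nat.zero_le n)) hb
  refine ⟨m, pre.antisymm ?_ (hf m)⟩
  rw [h]
  exact pre_of_le_of_step hf hmn

theorem exists_eq_succ_of_decreasing {a : G} {f : ℕ → G}
    (hf : ∀ n, gs.pre (f (n + 1)) (f n)) (ha : ∀ n, gs.pre a (f n)) :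
    ∃ n, f (n + 1) = f n := by
  obtain ⟨m, n, hmn, h⟩ :=
    exists_lt_eq_of_mem_Icc ha (fun n => pre_of_le_of_step_down hf (Nat.zero_le n))
  refine ⟨m, pre.antisymm (hf m) ?_⟩
  rw [h]
  exact pre_of_le_of_step_down hf hmn

/-- A nonempty set of positive elements closed under meets has a least element. -/
theorem exists_least_of_wedge_closed {X : Set G} (hne : X.Nonempty)
    (hpos : ∀ u ∈ X, gs.pre 1 u) (hw : ∀ u ∈ X, ∀ w ∈ X, gs.wedge u w ∈ X) :
    ∃ u ∈ X, ∀ w ∈ X, gs.pre u w := by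
  by_contra! H
  obtain ⟨u₀, hu₀⟩ := hne
  choose g hgX hg using H
  let step (u : X) : X := ⟨gs.wedge u (g u u.2), hw _ u.2 _ (hgX u u.2)⟩
  let f (n : ℕ) : G := (step^[n] ⟨u₀, hu₀⟩ : X)
  have hstep (n : ℕ) : f (n + 1) = gs.wedge (f n) (g (f n) (step^[n] ⟨u₀, hu₀⟩).2) := by
    simp only [f, Function.iterate_succ_apply']
    rfl
  obtain ⟨n, hn⟩ := exists_eq_succ_of_decreasing (f := f)
    (fun n => hstep n ▸ wedge_pre_left _ _) (fun n => hpos _ (step^[n] ⟨u₀, hu₀⟩).2)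
  rw [hstep] at hn
  exact hg _ _ (wedge_eq_left_iff.mp hn)

/-! ### Equivariant maps

An element `β` of `G` is regarded as standing for the conjugate `β⁻¹ * v * β` of a fixed element
`v`. Cycling, decycling and cyclic sliding then become meet-preserving self-maps of `G` which
commute with left multiplication by the centralizer of `v` and right multiplication by `Δ`. -/

variable (gs) in
/-- Meet-preserving maps commuting with left multiplication by `v` and `c` and with right
multiplication by powers of `Δ`. -/
structure IsEquivariant (v c : G) (f : G → G) : Prop where
  map_wedge : ∀ a b, f (gs.wedge a b) = gs.wedge (f a) (f b)
  map_mul_left : ∀ a, f (v * a) = v * f a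
  map_mul_left' : ∀ a, f (c * a) = c * f a
  map_mul_zpow : ∀ (k : ℤ) (a : G), f (a * gs.Δ ^ k) = f a * gs.Δ ^ k

namespace IsEquivariant

variable {v c : G} {f g : G → G}

theorem mono (hf : gs.IsEquivariant v c f) {a b : G} (h : gs.pre a b) : gs.pre (f a) (f b) := by
  rw [← wedge_eq_left_iff, ← hf.map_wedge, wedge_eq_left_iff.mpr h]

theorem map_inv_mul_left (hf : gs.IsEquivariant v c f) (a : G) : f (v⁻¹ * a) = v⁻¹ * f a := by
  rw [eq_inv_mul_iff_mul_eq, ← hf.map_mul_left, mul_inv_cancel_left]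

theorem map_pow_mul_left' (hf : gs.IsEquivariant v c f) (n : ℕ) (a : G) :
    f (c ^ n * a) = c ^ n * f a := by
  induction n with
  | zero => simp
  | succ n ih => rw [pow_succ', mul_assoc, hf.map_mul_left', ih, mul_assoc]

theorem map_mul_Delta (hf : gs.IsEquivariant v c f) (a : G) : f (a * gs.Δ) = f a * gs.Δ := by
  simpa using hf.map_mul_zpow 1 a

theorem inv (hf : gs.IsEquivariant v c f) : gs.IsEquivariant v⁻¹ c f :=
  ⟨hf.map_wedge, hf.map_inv_mul_left, hf.map_mul_left', hf.map_mul_zpow⟩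

theorem comp (hf : gs.IsEquivariant v c f) (hg : gs.IsEquivariant v c g) :
    gs.IsEquivariant v c (f ∘ g) where
  map_wedge a b := by simp [hf.map_wedge, hg.map_wedge]
  map_mul_left a := by simp [hf.map_mul_left, hg.map_mul_left]
  map_mul_left' a := by simp [hf.map_mul_left', hg.map_mul_left']
  map_mul_zpow k a := by simp [hf.map_mul_zpow, hg.map_mul_zpow]

theorem iterate (hf : gs.IsEquivariant v c f) (n : ℕ) : gs.IsEquivariant v c f^[n] := by
  induction n with
  | zero => exact ⟨fun _ _ => rfl, fun _ => rfl, fun _ => rfl, fun _ _ => rfl⟩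
  | succ n ih => rw [Function.iterate_succ]; exact ih.comp hf

theorem inv_mul (hf : gs.IsEquivariant v c f) (hc : Commute c v) :
    gs.IsEquivariant v c (fun a => c⁻¹ * f a) where
  map_wedge a b := by rw [hf.map_wedge, mul_wedge]
  map_mul_left a := by
    rw [hf.map_mul_left, ← mul_assoc, ← mul_assoc, hc.inv_left.eq]
  map_mul_left' a := by rw [hf.map_mul_left', mul_inv_cancel_left, inv_mul_cancel_left]
  map_mul_zpow k a := by rw [hf.map_mul_zpow, mul_assoc]

end IsEquivariant

variable (gs) in
/-- For `p = inf (β⁻¹ * v * β)`, this is `β` followed by the cycling conjugator of `β⁻¹ * v * β`.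
With `v⁻¹` and `-q` in place of `v` and `p` it describes decycling. -/
def cyclingMap (v : G) (p : ℤ) (β : G) : G :=
  gs.wedge (v * β * gs.Δ ^ (-p)) (β * gs.Δ)

variable (gs) in
/-- For `p = inf (β⁻¹ * v * β)` and `q = sup (β⁻¹ * v * β)`, this is `β` followed by the
preferred prefix of `β⁻¹ * v * β`. -/
def slidingMap (v : G) (p q : ℤ) (β : G) : G :=
  gs.wedge (gs.cyclingMap v p β) (gs.cyclingMap v⁻¹ (-q) β)

variable (gs) in
/-- The condition `p ≤ inf (β⁻¹ * v * β)`. With `v⁻¹` and `-q` in place of `v` and `p` it reads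
`sup (β⁻¹ * v * β) ≤ q`. -/
def InfGe (v : G) (p : ℤ) (β : G) : Prop := gs.pre β (v * β * gs.Δ ^ (-p))

variable {v c : G} {p q : ℤ} {f : G → G}

theorem InfGe.map {β : G} (h : gs.InfGe v p β) (hf : gs.IsEquivariant v c f) :
    gs.InfGe v p (f β) := by
  have := hf.mono h
  rwa [hf.map_mul_zpow, hf.map_mul_left] at this

theorem InfGe.map' {β : G} (h : gs.InfGe v⁻¹ p β) (hf : gs.IsEquivariant v c f) :
    gs.InfGe v⁻¹ p (f β) := h.map hf.inv

theorem InfGe.mul_zpow {β : G} (h : gs.InfGe v p β) (k : ℤ) : gs.InfGe v p (β * gs.Δ ^ k) := by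
  have := (pre_mul_zpow_iff k).mpr h
  unfold InfGe
  rwa [mul_assoc, ← zpow_add, add_comm, zpow_add, ← mul_assoc, mul_assoc v] at this

theorem infGe_mul_left_iff {g β : G} (hg : Commute g v) :
    gs.InfGe v p (g * β) ↔ gs.InfGe v p β := by
  unfold InfGe
  rw [← mul_assoc v, ← hg.eq, mul_assoc g, mul_assoc g, pre_mul_left_iff]

theorem InfGe.wedge {a b : G} (ha : gs.InfGe v p a) (hb : gs.InfGe v p b) :
    gs.InfGe v p (gs.wedge a b) := by
  unfold InfGe
  rw [mul_wedge, wedge_mul_zpow, pre_wedge_iff]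
  exact ⟨(wedge_pre_left a b).trans ha, (wedge_pre_right a b).trans hb⟩

theorem cyclingMap_wedge (a b : G) : gs.cyclingMap v p (gs.wedge a b) =
    gs.wedge (gs.cyclingMap v p a) (gs.cyclingMap v p b) :=
  eq_of_forall_pre_iff (gs := gs) fun d => by
    have := wedge_mul_zpow (gs := gs) 1 a b
    simp only [zpow_one] at this
    simp only [cyclingMap, mul_wedge, wedge_mul_zpow, this, pre_wedge_iff]
    tauto

theorem cyclingMap_mul_left {g : G} (hg : Commute g v) (a : G) :
    gs.cyclingMap v p (g * a) = g * gs.cyclingMap v p a := by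
  simp only [cyclingMap, mul_wedge, ← mul_assoc, hg.eq]

theorem cyclingMap_mul_zpow (k : ℤ) (a : G) :
    gs.cyclingMap v p (a * gs.Δ ^ k) = gs.cyclingMap v p a * gs.Δ ^ k := by
  simp only [cyclingMap, wedge_mul_zpow, mul_assoc, ← zpow_add, ← zpow_one_add, ← zpow_add_one,
    add_comm]

theorem isEquivariant_cyclingMap (hc : Commute c v) (p : ℤ) :
    gs.IsEquivariant v c (gs.cyclingMap v p) :=
  ⟨cyclingMap_wedge, cyclingMap_mul_left (Commute.refl v), cyclingMap_mul_left hc,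
    cyclingMap_mul_zpow⟩

theorem isEquivariant_cyclingMap_inv (hc : Commute c v) (p : ℤ) :
    gs.IsEquivariant v c (gs.cyclingMap v⁻¹ p) :=
  ⟨cyclingMap_wedge, cyclingMap_mul_left (Commute.refl v).inv_right,
    cyclingMap_mul_left hc.inv_right, cyclingMap_mul_zpow⟩

theorem slidingMap_mul_left {g : G} (hg : Commute g v) (a : G) :
    gs.slidingMap v p q (g * a) = g * gs.slidingMap v p q a := by
  rw [slidingMap, cyclingMap_mul_left hg, cyclingMap_mul_left hg.inv_right, ← mul_wedge,
    slidingMap]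

theorem isEquivariant_slidingMap (hc : Commute c v) (p q : ℤ) :
    gs.IsEquivariant v c (gs.slidingMap v p q) where
  map_wedge a b := eq_of_forall_pre_iff (gs := gs) fun d => by
    simp only [slidingMap, cyclingMap_wedge, pre_wedge_iff]
    tauto
  map_mul_left := slidingMap_mul_left (Commute.refl v)
  map_mul_left' := slidingMap_mul_left hc
  map_mul_zpow k a := by simp only [slidingMap, cyclingMap_mul_zpow, wedge_mul_zpow]

theorem slidingMap_inv (v : G) (p q : ℤ) : gs.slidingMap v⁻¹ (-q) (-p) = gs.slidingMap v p q := by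
  funext β
  rw [slidingMap, slidingMap, inv_inv, neg_neg, wedge_comm]

theorem IsEquivariant.map_cyclingMap (hf : gs.IsEquivariant v c f) (a : G) :
    f (gs.cyclingMap v p a) = gs.cyclingMap v p (f a) := by
  rw [cyclingMap, hf.map_wedge, hf.map_mul_zpow, hf.map_mul_left, hf.map_mul_Delta, cyclingMap]

theorem IsEquivariant.map_slidingMap (hf : gs.IsEquivariant v c f) (a : G) :
    f (gs.slidingMap v p q a) = gs.slidingMap v p q (f a) := by
  rw [slidingMap, hf.map_wedge, hf.map_cyclingMap, hf.inv.map_cyclingMap, slidingMap]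

theorem InfGe.cyclingMap_eq {β : G} (h : gs.InfGe v (p + 1) β) :
    gs.cyclingMap v p β = β * gs.Δ := by
  refine wedge_eq_right_iff.mpr ?_
  have := pre_mul_Delta_iff.mpr h
  rwa [mul_assoc, ← zpow_add_one, show -(p + 1) + 1 = -p by ring] at this

theorem cyclingMap_pre_mul_Delta (v : G) (p : ℤ) (β : G) :
    gs.pre (gs.cyclingMap v p β) (β * gs.Δ) := wedge_pre_right _ _

theorem slidingMap_pre_cyclingMap_inv (v : G) (p q : ℤ) (β : G) :
    gs.pre (gs.slidingMap v p q β) (gs.cyclingMap v⁻¹ (-q) β) := wedge_pre_right _ _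

theorem InfGe.slidingMap_eq {β : G} (h : gs.InfGe v (p + 1) β) :
    gs.slidingMap v p q β = gs.cyclingMap v⁻¹ (-q) β := by
  rw [slidingMap, h.cyclingMap_eq]
  exact wedge_eq_right_iff.mpr (cyclingMap_pre_mul_Delta _ _ _)

theorem iterate_pre_iterate {g h : G → G} (hg : ∀ a b, gs.pre a b → gs.pre (g a) (g b))
    (hgh : ∀ a, gs.pre (g a) (h a)) (n : ℕ) (a : G) : gs.pre (g^[n] a) (h^[n] a) := by
  induction n with
  | zero => exact pre_refl gs a
  | succ n ih =>
    rw [Function.iterate_succ_apply', Function.iterate_succ_apply']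
    exact (hg _ _ ih).trans (hgh _)

/-- Cycling eventually increases the infimum if it is not maximal. -/
theorem exists_infGe_iterate_cyclingMap {s : G} (hs : gs.InfGe v (p + 1) s) (β : G) :
    ∃ k, gs.InfGe v (p + 1) ((gs.cyclingMap v p)^[k] β) := by
  have hC := isEquivariant_cyclingMap (gs := gs) (Commute.one_left v) p
  obtain ⟨m, hm, -⟩ := gs.exists_zpow_neg_pre_pre_zpow (s⁻¹ * β)
  have hsβ : gs.pre (s * gs.Δ ^ (-m : ℤ)) β := by
    simpa using (pre_mul_left_iff s).mpr hm
  have hs' := hs.mul_zpow (-m)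
  set a : ℕ → G := fun k => (gs.cyclingMap v p)^[k] β * gs.Δ ^ (-k : ℤ) with ha
  have hsucc (k : ℕ) : a (k + 1) = gs.cyclingMap v p (a k) * gs.Δ ^ (-1 : ℤ) := by
    simp only [ha, Function.iterate_succ_apply', hC.map_mul_zpow, mul_assoc, ← zpow_add]
    congr 2
    push_cast
    ring
  have hdown (k : ℕ) : gs.pre (a (k + 1)) (a k) := by
    rw [hsucc]
    have := (pre_mul_zpow_iff (-1)).mpr (cyclingMap_pre_mul_Delta (gs := gs) v p (a k))
    simpa using this
  have hbelow (k : ℕ) : gs.pre (s * gs.Δ ^ (-m : ℤ)) (a k) := by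
    induction k with
    | zero => simpa [ha] using hsβ
    | succ k ih =>
      have := (pre_mul_zpow_iff (-1)).mpr (hC.mono ih)
      rw [hs'.cyclingMap_eq, ← hsucc] at this
      simpa using this
  obtain ⟨k, hk⟩ := exists_eq_succ_of_decreasing hdown hbelow
  refine ⟨k, ?_⟩
  have hak : gs.InfGe v (p + 1) (a k) := by
    have h1 : gs.pre (a k * gs.Δ) (v * a k * gs.Δ ^ (-p)) := by
      rw [hsucc, zpow_neg_one, mul_inv_eq_iff_eq_mul] at hk
      rw [← hk]
      exact wedge_pre_left _ _
    have := (pre_mul_zpow_iff (-1)).mpr h1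
    rw [mul_assoc _ _ (gs.Δ ^ (-1 : ℤ)), mul_assoc _ _ (gs.Δ ^ (-1 : ℤ)), ← zpow_add] at this
    unfold InfGe
    rw [neg_add]
    simpa using this
  simpa [ha, mul_assoc] using hak.mul_zpow k

/-- If decycling coincides with sliding and the canonical length is at least two, then
decycling increases the infimum. -/
theorem infGe_cyclingMap_inv_of_pre {U : G} (hq : p + 2 ≤ q)
    (h : gs.pre (gs.cyclingMap v⁻¹ (-q) U) (gs.cyclingMap v p U)) :
    gs.InfGe v (p + 1) (gs.cyclingMap v⁻¹ (-q) U) := by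
  have hE := isEquivariant_cyclingMap_inv (gs := gs) (Commute.one_left v) (-q)
  unfold InfGe
  rw [← hE.map_mul_left, ← hE.map_mul_zpow]
  refine pre_wedge_iff.mpr ⟨?_, ?_⟩
  · have h1 := (cyclingMap_pre_mul_Delta (gs := gs) v⁻¹ (-q) U).trans
      (b := U * gs.Δ) (c := U * gs.Δ ^ (q - p - 1))
      (by simpa using mul_zpow_pre_mul_zpow (gs := gs) U (k := 1) (l := q - p - 1) (by lia))
    convert h1 using 1
    simp only [mul_assoc, ← zpow_add, inv_mul_cancel_left]
    congr 2
    ring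
  · convert h.trans (wedge_pre_left _ _) using 1
    rw [mul_assoc, ← zpow_add_one]
    congr 2
    ring

theorem infGe_of_infGe_cyclingMap {N : ℕ} (hN : 0 < N) (hc : Commute c v) {B : G}
    (hp : gs.InfGe v p B) (hq : gs.InfGe v⁻¹ (-q) B) (hB : (gs.slidingMap v p q)^[N] B = c * B)
    (hA : gs.InfGe v (p + 1) (gs.cyclingMap v p B)) : gs.InfGe v (p + 1) B := by
  have hC := isEquivariant_cyclingMap (gs := gs) hc p
  have hE := isEquivariant_cyclingMap_inv (gs := gs) hc (-q)
  have hL := isEquivariant_slidingMap (gs := gs) hc p q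
  obtain hpq | hpq : q ≤ p + 1 ∨ p + 2 ≤ q := by lia
  · have hCB : gs.cyclingMap v p B = v * B * gs.Δ ^ (-p) := by
      refine wedge_eq_left_iff.mpr ?_
      have h1 := (pre_mul_zpow_iff (-p)).mpr ((pre_mul_left_iff v).mpr hq)
      refine h1.trans ?_
      have h2 := mul_zpow_pre_mul_zpow (gs := gs) B (k := q - p) (l := 1) (by lia)
      convert h2 using 1
      · simp only [neg_neg, mul_assoc, mul_inv_cancel_left, ← zpow_add]
        congr 2
      · simp
    rw [hCB, mul_assoc, infGe_mul_left_iff (Commute.refl v)] at hA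
    simpa [mul_assoc] using hA.mul_zpow p
  set E := gs.cyclingMap v⁻¹ (-q) with hEdef
  set L := gs.slidingMap v p q with hLdef
  set C := gs.cyclingMap v p with hCdef
  set A := C B with hAdef
  have hLE (k : ℕ) (a : G) : gs.pre (L^[k] a) (E^[k] a) :=
    iterate_pre_iterate (fun _ _ => hL.mono) (slidingMap_pre_cyclingMap_inv v p q) k a
  have hLA : L^[N] A = c * A := by
    rw [hAdef, (hL.iterate N).map_cyclingMap, hB]
    exact hC.map_mul_left' B
  have hEA : E^[N] A = c * A := by
    rw [← hLA]
    have (k : ℕ) : E^[k] A = L^[k] A := by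
      induction k with
      | zero => rfl
      | succ k ih =>
        rw [Function.iterate_succ_apply', Function.iterate_succ_apply', ih]
        exact ((hA.map (hL.iterate k)).slidingMap_eq).symm
    exact this N
  set e : G → G := fun a => c⁻¹ * E^[N] a with hedef
  have he : gs.IsEquivariant v c e := (hE.iterate N).inv_mul hc
  have heA : e A = A := by simp only [hedef, hEA, inv_mul_cancel_left]
  have hBA : gs.pre B A := pre_wedge_iff.mpr
    ⟨hp, by simpa using mul_zpow_pre_mul_zpow (gs := gs) B (k := 0) (l := 1) (by lia)⟩
  have hBe : gs.pre B (e B) := by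
    have := (pre_mul_left_iff c⁻¹).mpr (hLE N B)
    rwa [hB, inv_mul_cancel_left] at this
  obtain ⟨k, hk⟩ := exists_eq_succ_of_increasing (f := fun k => e^[k] B) (b := A)
    (fun k => (he.iterate k).mono hBe)
    (fun k => by simpa [Function.iterate_fixed heA] using (he.iterate k).mono hBA)
  have hek := he.iterate k
  have hBU : gs.pre B (e^[k] B) :=
    pre_of_le_of_step (f := fun k => e^[k] B) (fun k => (he.iterate k).mono hBe) (Nat.zero_le k)
  have hLU : L^[N] (e^[k] B) = c * e^[k] B := by
    have hcomm : Function.Commute e^[k] L := hek.map_slidingMap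
    rw [← (hcomm.iterate_right N).eq, hB, hek.map_mul_left']
  have hCU : C (e^[k] B) = A := by
    exact (hek.map_cyclingMap B).symm.trans (Function.iterate_fixed heA k)
  rw [Function.iterate_succ_apply'] at hk
  set U := e^[k] B
  have hEU : E^[N] U = c * U := by
    rw [← inv_mul_eq_iff_eq_mul]
    exact hk
  obtain ⟨M, rfl⟩ : ∃ M, N = M + 1 := ⟨N - 1, by lia⟩
  have hLEU : L^[M] (E U) = c * U := by
    refine pre.antisymm (gs := gs) ?_ ?_
    · rw [← hEU]
      exact hLE M (E U)
    · rw [← hLU]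
      exact (hL.iterate M).mono (slidingMap_pre_cyclingMap_inv v p q U)
  have hLeqE : L U = E U := by
    have hcomm : Function.Commute L E := hL.inv.map_cyclingMap
    have h1 : L^[M + 1] (E U) = c * E U := by
      rw [(hcomm.iterate_left (M + 1)).eq, hLU, hE.map_mul_left']
    rw [Function.iterate_succ_apply', hLEU, hL.map_mul_left'] at h1
    exact mul_left_cancel h1
  have hinfEU : gs.InfGe v (p + 1) (E U) :=
    infGe_cyclingMap_inv_of_pre hpq (by
      rw [← hEdef, ← hLeqE]
      exact wedge_pre_left _ _)
  have hinfU : gs.InfGe v (p + 1) U := by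
    rw [← infGe_mul_left_iff hc, ← hEU]
    exact hinfEU.map (hE.iterate M)
  have hUB : gs.pre U B := by
    rw [← pre_mul_Delta_iff, ← hinfU.cyclingMap_eq, ← hCdef, hCU]
    exact cyclingMap_pre_mul_Delta v p B
  rwa [hBU.antisymm hUB]

/-- If `v` is periodic under cyclic sliding and some conjugate of `v` has infimum greater than `p`,
then so does `v`. -/
theorem infGe_one_of_periodic {N : ℕ} (hN : 0 < N) (hp : gs.InfGe v p 1)
    (hq : gs.InfGe v⁻¹ (-q) 1) (hc : Commute ((gs.slidingMap v p q)^[N] 1) v) {s : G}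
    (hs : gs.InfGe v (p + 1) s) : gs.InfGe v (p + 1) 1 := by
  have hC := isEquivariant_cyclingMap (gs := gs) hc p
  obtain ⟨k, hk⟩ := exists_infGe_iterate_cyclingMap hs 1
  induction k with
  | zero => exact hk
  | succ k ih =>
    rw [Function.iterate_succ_apply'] at hk
    refine ih (infGe_of_infGe_cyclingMap hN hc (hp.map (hC.iterate k))
      (hq.map' (hC.iterate k)) ?_ hk)
    have hCk := hC.iterate k
    have hcomm : Function.Commute (gs.cyclingMap v p)^[k] (gs.slidingMap v p q) :=
      hCk.map_slidingMap
    rw [← (hcomm.iterate_right N).eq, ← hCk.map_mul_left', mul_one]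

/-! ### Infimum, supremum and cyclic sliding -/

variable (gs) in
theorem Delta_ne_one [Nontrivial G] : gs.Δ ≠ 1 := by
  intro h
  obtain ⟨x, hx⟩ := exists_ne (1 : G)
  obtain ⟨n, h1, h2⟩ := gs.exists_zpow_neg_pre_pre_zpow x
  simp only [h, one_zpow] at h1 h2
  exact hx (h2.antisymm h1)

theorem zpow_pre_zpow_iff [Nontrivial G] {k l : ℤ} :
    gs.pre (gs.Δ ^ k) (gs.Δ ^ l) ↔ k ≤ l := by
  refine ⟨fun h => ?_, zpow_pre_zpow⟩
  by_contra! hlt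
  have h1 : gs.pre (gs.Δ ^ (l + 1)) (gs.Δ ^ l) := (zpow_pre_zpow (by lia)).trans h
  have h2 := h1.antisymm (zpow_pre_zpow (by lia))
  rw [zpow_add_one, mul_eq_left] at h2
  exact gs.Delta_ne_one h2

theorem zpow_pre_iff_le_ginf [Nontrivial G] {p : ℤ} {x : G} :
    gs.pre (gs.Δ ^ p) x ↔ p ≤ gs.ginf x := by
  obtain ⟨n, h1, h2⟩ := gs.exists_zpow_neg_pre_pre_zpow x
  have hbdd : BddAbove {p : ℤ | gs.pre (gs.Δ ^ p) x} :=
    ⟨n, fun p hp => zpow_pre_zpow_iff.mp (pre.trans hp h2)⟩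
  have hmem : gs.pre (gs.Δ ^ gs.ginf x) x := Int.csSup_mem ⟨-n, h1⟩ hbdd
  exact ⟨fun h => le_csSup hbdd h, fun h => (zpow_pre_zpow h).trans hmem⟩

theorem pre_zpow_iff_gsup_le [Nontrivial G] {q : ℤ} {x : G} :
    gs.pre x (gs.Δ ^ q) ↔ gs.gsup x ≤ q := by
  obtain ⟨n, h1, h2⟩ := gs.exists_zpow_neg_pre_pre_zpow x
  have hbdd : BddBelow {q : ℤ | gs.pre x (gs.Δ ^ q)} :=
    ⟨-n, fun q hq => zpow_pre_zpow_iff.mp (h1.trans hq)⟩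
  have hmem : gs.pre x (gs.Δ ^ gs.gsup x) := Int.csInf_mem ⟨n, h2⟩ hbdd
  exact ⟨fun h => csInf_le hbdd h, fun h => hmem.trans (zpow_pre_zpow h)⟩

theorem infGe_iff [Nontrivial G] {β : G} : gs.InfGe v p β ↔ p ≤ gs.ginf (β⁻¹ * v * β) := by
  rw [← zpow_pre_iff_le_ginf, InfGe, pre_mul_zpow_iff_mul_zpow_neg_pre, neg_neg,
    ← pre_mul_left_iff β (a := gs.Δ ^ p)]
  simp only [← mul_assoc, mul_inv_cancel, one_mul]

theorem infGe_inv_iff [Nontrivial G] {β : G} :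
    gs.InfGe v⁻¹ (-q) β ↔ gs.gsup (β⁻¹ * v * β) ≤ q := by
  rw [← pre_zpow_iff_gsup_le, InfGe, neg_neg, ← pre_mul_left_iff (β⁻¹ * v)]
  simp only [mul_assoc, mul_inv_cancel_left, inv_mul_cancel_left]

theorem pp_conj (v β : G) : gs.pp (β⁻¹ * v * β) =
    β⁻¹ * gs.slidingMap v (gs.ginf (β⁻¹ * v * β)) (gs.gsup (β⁻¹ * v * β)) β :=
  eq_of_forall_pre_iff (gs := gs) fun d => by
    simp only [pp, slidingMap, cyclingMap, mul_wedge, pre_wedge_iff, mul_inv_rev, inv_inv,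
      mul_assoc, neg_neg, inv_mul_cancel_left]
    tauto

theorem sl_conj {β : G} (hp : gs.ginf (β⁻¹ * v * β) = p) (hq : gs.gsup (β⁻¹ * v * β) = q) :
    gs.sl (β⁻¹ * v * β) = (gs.slidingMap v p q β)⁻¹ * v * gs.slidingMap v p q β := by
  rw [sl, pp_conj, hp, hq]
  simp only [mul_inv_rev, inv_inv, mul_assoc, mul_inv_cancel_left]

theorem ginf_le_ginf_sl [Nontrivial G] (v : G) : gs.ginf v ≤ gs.ginf (gs.sl v) := by
  have h : gs.InfGe v (gs.ginf v) 1 := infGe_iff.mpr (by simp)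
  have h1 := h.map (isEquivariant_slidingMap (Commute.one_left v) (gs.ginf v) (gs.gsup v))
  have h2 := sl_conj (gs := gs) (v := v) (β := 1) rfl rfl
  simp only [inv_one, one_mul, mul_one] at h2
  rw [h2]
  exact infGe_iff.mp h1

theorem gsup_sl_le_gsup [Nontrivial G] (v : G) : gs.gsup (gs.sl v) ≤ gs.gsup v := by
  have h : gs.InfGe v⁻¹ (-gs.gsup v) 1 := infGe_inv_iff.mpr (by simp)
  have h1 := h.map' (isEquivariant_slidingMap (Commute.one_left v) (gs.ginf v) (gs.gsup v))
  have h2 := sl_conj (gs := gs) (v := v) (β := 1) rfl rfl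
  simp only [inv_one, one_mul, mul_one] at h2
  rw [h2]
  exact infGe_inv_iff.mp h1

theorem ginf_gsup_iterate_sl_of_periodic [Nontrivial G] {m : ℕ} (hm : 0 < m)
    (hv : gs.sl^[m] v = v) (k : ℕ) :
    gs.ginf (gs.sl^[k] v) = gs.ginf v ∧ gs.gsup (gs.sl^[k] v) = gs.gsup v := by
  have hinf : Monotone fun k => gs.ginf (gs.sl^[k] v) := monotone_nat_of_le_succ fun k => by
    rw [Function.iterate_succ_apply']
    exact ginf_le_ginf_sl _
  have hsup : Antitone fun k => gs.gsup (gs.sl^[k] v) := antitone_nat_of_succ_le fun k => by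
    rw [Function.iterate_succ_apply']
    exact gsup_sl_le_gsup _
  have hmk : gs.sl^[m * k] v = v := by
    rw [Function.iterate_mul]
    exact Function.iterate_fixed hv k
  have hle : k ≤ m * k := Nat.le_mul_of_pos_left k hm
  have h1 := hinf (Nat.zero_le k)
  have h2 := hinf hle
  have h3 := hsup (Nat.zero_le k)
  have h4 := hsup hle
  simp only [hmk, Function.iterate_zero, id_eq] at h1 h2 h3 h4
  exact ⟨le_antisymm h2 h1, le_antisymm h3 h4⟩

theorem iterate_sl_eq_conj (h : ∀ k, gs.ginf (gs.sl^[k] v) = p ∧ gs.gsup (gs.sl^[k] v) = q)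
    (k : ℕ) : gs.sl^[k] v =
      ((gs.slidingMap v p q)^[k] 1)⁻¹ * v * (gs.slidingMap v p q)^[k] 1 := by
  induction k with
  | zero => simp
  | succ k ih =>
    have hk := h k
    rw [ih] at hk
    rw [Function.iterate_succ_apply', ih, sl_conj hk.1 hk.2, Function.iterate_succ_apply']

theorem commute_of_conj_eq {g : G} (h : g⁻¹ * v * g = v) : Commute g v := by
  rw [mul_assoc, inv_mul_eq_iff_eq_mul] at h
  exact h.symm

theorem ginf_gsup_of_periodic [Nontrivial G] {m : ℕ} (hm : 0 < m) (hv : gs.sl^[m] v = v) (s : G) :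
    gs.ginf (s⁻¹ * v * s) ≤ gs.ginf v ∧ gs.gsup v ≤ gs.gsup (s⁻¹ * v * s) := by
  set p := gs.ginf v with hp
  set q := gs.gsup v with hq
  have hk := iterate_sl_eq_conj (ginf_gsup_iterate_sl_of_periodic hm hv) m
  rw [hv] at hk
  have hc := commute_of_conj_eq hk.symm
  have hp1 : gs.InfGe v p 1 := infGe_iff.mpr (by simp [hp])
  have hq1 : gs.InfGe v⁻¹ (-q) 1 := infGe_inv_iff.mpr (by simp [hq])
  constructor <;> by_contra! hlt
  · have := infGe_iff.mp
      (infGe_one_of_periodic hm hp1 hq1 hc (infGe_iff.mpr (Int.add_one_le_of_lt hlt)))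
    simp [← hp] at this
  · have hs : gs.InfGe v⁻¹ (-q + 1) s := by
      rw [show -q + 1 = -(q - 1) by ring]
      exact infGe_inv_iff.mpr (by lia)
    have h1 : gs.InfGe v⁻¹ (-q + 1) 1 := by
      refine infGe_one_of_periodic (q := -p) hm hq1 (by simpa using hp1) ?_ hs
      rw [slidingMap_inv]
      exact hc.inv_right
    rw [show -q + 1 = -(q - 1) by ring, infGe_inv_iff] at h1
    simp [← hq] at h1

/-! ### The super summit set and sliding circuits -/

theorem mem_SSS_of_mem_SC [Nontrivial G] {x y : G} (hy : y ∈ gs.SC x) : y ∈ gs.SSS x := by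
  obtain ⟨⟨α, rfl⟩, m, hm, hfix⟩ := hy
  refine ⟨⟨α, rfl⟩, ?_⟩
  rintro z ⟨β, rfl⟩
  have := ginf_gsup_of_periodic hm hfix (α⁻¹ * β)
  simpa [mul_assoc] using this

theorem ginf_gsup_eq_of_mem_SSS {x v w : G} (hv : v ∈ gs.SSS x) (hw : w ∈ gs.SSS x) :
    gs.ginf w = gs.ginf v ∧ gs.gsup w = gs.gsup v :=
  ⟨le_antisymm (hv.2 w hw.1).1 (hw.2 v hv.1).1, le_antisymm (hw.2 v hv.1).2 (hv.2 w hw.1).2⟩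

variable (gs) in
/-- For `v` in its super summit set, the condition that `β⁻¹ * v * β` is also in it. -/
def Summit (v β : G) : Prop := gs.InfGe v (gs.ginf v) β ∧ gs.InfGe v⁻¹ (-gs.gsup v) β

variable (gs) in
/-- The sliding map of an element `v` of its super summit set. -/
noncomputable def summitSliding (v : G) : G → G := gs.slidingMap v (gs.ginf v) (gs.gsup v)

theorem isEquivariant_summitSliding (hc : Commute c v) :
    gs.IsEquivariant v c (gs.summitSliding v) := isEquivariant_slidingMap hc _ _

theorem Summit.map {β : G} (h : gs.Summit v β) (hf : gs.IsEquivariant v c f) :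
    gs.Summit v (f β) := ⟨h.1.map hf, h.2.map' hf⟩

theorem Summit.iterate {β : G} (h : gs.Summit v β) (n : ℕ) :
    gs.Summit v ((gs.summitSliding v)^[n] β) :=
  h.map ((isEquivariant_summitSliding (Commute.one_left v)).iterate n)

theorem Summit.mul_left_iff {g β : G} (hg : Commute g v) :
    gs.Summit v (g * β) ↔ gs.Summit v β :=
  and_congr (infGe_mul_left_iff hg) (infGe_mul_left_iff hg.inv_right)

theorem Summit.wedge {a b : G} (ha : gs.Summit v a) (hb : gs.Summit v b) :
    gs.Summit v (gs.wedge a b) := ⟨ha.1.wedge hb.1, ha.2.wedge hb.2⟩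

theorem Summit.mul_zpow {a : G} (ha : gs.Summit v a) (k : ℤ) :
    gs.Summit v (a * gs.Δ ^ k) := ⟨ha.1.mul_zpow k, ha.2.mul_zpow k⟩

section

variable [Nontrivial G] {x : G}

theorem one_mem_Summit (v : G) : gs.Summit v (1 : G) :=
  ⟨infGe_iff.mpr (by simp), infGe_inv_iff.mpr (by simp)⟩

theorem conj_mem_SSS_iff_mem_Summit (hv : v ∈ gs.SSS x) {β : G} :
    β⁻¹ * v * β ∈ gs.SSS x ↔ gs.Summit v β := by
  obtain ⟨⟨α, rfl⟩, hmax⟩ := hv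
  have hconj : ∃ γ, γ⁻¹ * x * γ = β⁻¹ * (α⁻¹ * x * α) * β := ⟨α * β, by simp [mul_assoc]⟩
  rw [Summit, infGe_iff, infGe_inv_iff]
  refine ⟨fun h => h.2 _ ⟨α, rfl⟩, fun h => ⟨hconj, fun z hz => ?_⟩⟩
  exact ⟨(hmax z hz).1.trans h.1, h.2.trans (hmax z hz).2⟩

theorem pp_conj_of_mem_Summit (hv : v ∈ gs.SSS x) {β : G} (hβ : gs.Summit v β) :
    gs.pp (β⁻¹ * v * β) = β⁻¹ * gs.summitSliding v β := by
  obtain ⟨h1, h2⟩ := ginf_gsup_eq_of_mem_SSS hv ((conj_mem_SSS_iff_mem_Summit hv).mpr hβ)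
  rw [pp_conj, h1, h2, summitSliding]

theorem iterate_sl_conj (hv : v ∈ gs.SSS x) {β : G} (hβ : gs.Summit v β) (k : ℕ) :
    gs.sl^[k] (β⁻¹ * v * β) =
      ((gs.summitSliding v)^[k] β)⁻¹ * v * (gs.summitSliding v)^[k] β := by
  induction k with
  | zero => rfl
  | succ k ih =>
    obtain ⟨h1, h2⟩ := ginf_gsup_eq_of_mem_SSS hv
      ((conj_mem_SSS_iff_mem_Summit hv).mpr (hβ.iterate k))
    rw [Function.iterate_succ_apply', ih, sl_conj h1 h2, Function.iterate_succ_apply',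
      summitSliding]

theorem iterate_sl (hv : v ∈ gs.SSS x) (k : ℕ) :
    gs.sl^[k] v = ((gs.summitSliding v)^[k] 1)⁻¹ * v * (gs.summitSliding v)^[k] 1 := by
  simpa using iterate_sl_conj hv (one_mem_Summit v) k

theorem transport_conj (hv : v ∈ gs.SSS x) {γ β : G} (hγ : gs.Summit v γ)
    (hβ : gs.Summit v (γ * β)) : gs.transport (γ⁻¹ * v * γ) β =
      (gs.summitSliding v γ)⁻¹ * gs.summitSliding v (γ * β) := by
  have h : β⁻¹ * (γ⁻¹ * v * γ) * β = (γ * β)⁻¹ * v * (γ * β) := by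
    simp only [mul_inv_rev, mul_assoc]
  rw [transport, h, pp_conj_of_mem_Summit hv hγ, pp_conj_of_mem_Summit hv hβ]
  simp only [mul_inv_rev, inv_inv, mul_assoc, mul_inv_cancel_left]

theorem transportIter_eq (hv : v ∈ gs.SSS x) {β : G} (hβ : gs.Summit v β) (k : ℕ) :
    gs.transportIter v β k =
      ((gs.summitSliding v)^[k] 1)⁻¹ * (gs.summitSliding v)^[k] β := by
  induction k with
  | zero => simp [transportIter]
  | succ k ih =>
    rw [transportIter, ih, iterate_sl hv, transport_conj hv ((one_mem_Summit v).iterate k),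
      mul_inv_cancel_left, Function.iterate_succ_apply', Function.iterate_succ_apply']
    rw [mul_inv_cancel_left]
    exact hβ.iterate k

/-! ### Pullbacks -/

theorem isPullback_conj_iff (hv : v ∈ gs.SSS x) {γ s u : G} (hγ : gs.Summit v γ) :
    gs.IsPullback x (γ⁻¹ * v * γ) s u ↔
      (gs.pre γ (γ * u) ∧ gs.Summit v (γ * u) ∧
        gs.pre (gs.summitSliding v γ * s) (gs.summitSliding v (γ * u))) ∧
      ∀ β, gs.pre γ β → gs.Summit v β →
        gs.pre (gs.summitSliding v γ * s) (gs.summitSliding v β) → gs.pre (γ * u) β := by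
  have hmem (u : G) : u ∈ gs.P ↔ gs.pre γ (γ * u) := by simp [pre]
  have hSSS (u : G) : u⁻¹ * (γ⁻¹ * v * γ) * u ∈ gs.SSS x ↔ gs.Summit v (γ * u) := by
    rw [← conj_mem_SSS_iff_mem_Summit hv]
    simp only [mul_inv_rev, mul_assoc]
  have htr {u : G} (hu : gs.Summit v (γ * u)) : gs.pre s (gs.transport (γ⁻¹ * v * γ) u) ↔
      gs.pre (gs.summitSliding v γ * s) (gs.summitSliding v (γ * u)) := by
    rw [transport_conj hv hγ hu, pre_mul_left_iff_inv]
  unfold IsPullback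
  constructor
  · rintro ⟨h1, h2, h3, h4⟩
    have h2' := (hSSS u).mp h2
    refine ⟨⟨(hmem u).mp h1, h2', (htr h2').mp h3⟩, fun β hβ hβS hβs => ?_⟩
    rw [pre_mul_left_iff_inv]
    exact h4 _ ((hmem _).mpr (by simpa using hβ)) ((hSSS _).mpr (by simpa using hβS))
      ((htr (by simpa using hβS)).mpr (by simpa using hβs))
  · rintro ⟨⟨h1, h2, h3⟩, h4⟩
    refine ⟨(hmem u).mpr h1, (hSSS u).mpr h2, (htr h2).mpr h3, fun w hw hwS hws => ?_⟩
    have hwS' := (hSSS w).mp hwS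
    exact (pre_mul_left_iff γ).mp (h4 _ ((hmem w).mp hw) hwS' ((htr hwS').mp hws))

theorem pullbackOne_conj (hv : v ∈ gs.SSS x) {γ : G} (hγ : gs.Summit v γ) (s : G) :
    (gs.pre γ (γ * gs.pullbackOne x (γ⁻¹ * v * γ) s) ∧
        gs.Summit v (γ * gs.pullbackOne x (γ⁻¹ * v * γ) s) ∧
        gs.pre (gs.summitSliding v γ * s)
          (gs.summitSliding v (γ * gs.pullbackOne x (γ⁻¹ * v * γ) s))) ∧
      ∀ β, gs.pre γ β → gs.Summit v β →
        gs.pre (gs.summitSliding v γ * s) (gs.summitSliding v β) →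
        gs.pre (γ * gs.pullbackOne x (γ⁻¹ * v * γ) s) β := by
  rw [← isPullback_conj_iff hv hγ]
  have hL := isEquivariant_summitSliding (gs := gs) (Commute.one_left v)
  suffices ∃ u, gs.IsPullback x (γ⁻¹ * v * γ) s u from
    @Classical.epsilon_spec G (fun u => gs.IsPullback x (γ⁻¹ * v * γ) s u) this
  let X : Set G := {u | gs.pre 1 u ∧ gs.Summit v (γ * u) ∧
    gs.pre (gs.summitSliding v γ * s) (gs.summitSliding v (γ * u))}
  obtain ⟨u, hu, hmin⟩ := exists_least_of_wedge_closed (gs := gs) (X := X)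
    (by
      obtain ⟨n, -, hn⟩ := gs.exists_zpow_neg_pre_pre_zpow s
      refine ⟨gs.Δ ^ (n : ℤ), ?_, hγ.mul_zpow n, ?_⟩
      · simpa using zpow_pre_zpow (gs := gs) (k := 0) (l := n) (by lia)
      · rw [hL.map_mul_zpow, pre_mul_left_iff]
        exact hn)
    (fun u hu => hu.1)
    (fun a ha b hb => by
      refine ⟨pre_wedge_iff.mpr ⟨ha.1, hb.1⟩, ?_, ?_⟩
      · rw [mul_wedge]
        exact ha.2.1.wedge hb.2.1
      · rw [mul_wedge, hL.map_wedge]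
        exact pre_wedge_iff.mpr ⟨ha.2.2, hb.2.2⟩)
  refine ⟨u, (isPullback_conj_iff hv hγ).mpr ⟨⟨?_, hu.2.1, hu.2.2⟩, fun β h1 h2 h3 => ?_⟩⟩
  · simpa using (pre_mul_left_iff γ).mpr hu.1
  · rw [pre_mul_left_iff_inv]
    exact hmin _ ⟨by simpa [pre] using h1, by simpa using h2, by simpa using h3⟩

theorem pullbackIter_conj (hv : v ∈ gs.SSS x) {s : G} (hs : s ∈ gs.P) (k : ℕ) {γ : G}
    (hγ : gs.Summit v γ) (hγs : gs.Summit v ((gs.summitSliding v)^[k] γ * s)) :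
    (gs.pre γ (γ * gs.pullbackIter x (γ⁻¹ * v * γ) k s) ∧
        gs.Summit v (γ * gs.pullbackIter x (γ⁻¹ * v * γ) k s) ∧
        gs.pre ((gs.summitSliding v)^[k] γ * s)
          ((gs.summitSliding v)^[k] (γ * gs.pullbackIter x (γ⁻¹ * v * γ) k s))) ∧
      ∀ β, gs.pre γ β → gs.Summit v β →
        gs.pre ((gs.summitSliding v)^[k] γ * s) ((gs.summitSliding v)^[k] β) →
        gs.pre (γ * gs.pullbackIter x (γ⁻¹ * v * γ) k s) β := by
  have hL := isEquivariant_summitSliding (gs := gs) (Commute.one_left v)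
  induction k generalizing γ with
  | zero =>
    refine ⟨⟨?_, hγs, pre_refl gs _⟩, fun β _ _ h => h⟩
    simpa [pre, pullbackIter] using hs
  | succ k ih =>
    rw [pullbackIter]
    have hsl : gs.sl (γ⁻¹ * v * γ) =
        (gs.summitSliding v γ)⁻¹ * v * gs.summitSliding v γ := iterate_sl_conj hv hγ 1
    obtain ⟨⟨h1, h2, h3⟩, h4⟩ := ih (hγ.iterate 1) hγs
    rw [hsl]
    set t := gs.pullbackIter x ((gs.summitSliding v γ)⁻¹ * v * gs.summitSliding v γ) k s
    obtain ⟨⟨g1, g2, g3⟩, g4⟩ := pullbackOne_conj hv hγ t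
    refine ⟨⟨g1, g2, h3.trans ((hL.iterate k).mono g3)⟩, fun β hβ hβS hβs => ?_⟩
    exact g4 β hβ hβS (h4 _ (hL.mono hβ) (hβS.iterate 1) hβs)

theorem pullbackIter_isLeast (hv : v ∈ gs.SSS x) {s : G} (hs : s ∈ gs.P)
    (hvs : gs.Summit v s) {k : ℕ} (hk : gs.sl^[k] v = v) :
    (gs.pre 1 (gs.pullbackIter x v k s) ∧ gs.Summit v (gs.pullbackIter x v k s) ∧
        gs.pre s (gs.transportIter v (gs.pullbackIter x v k s) k)) ∧
      ∀ β, gs.pre 1 β → gs.Summit v β → gs.pre s (gs.transportIter v β k) →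
        gs.pre (gs.pullbackIter x v k s) β := by
  have hcomm := commute_of_conj_eq ((iterate_sl hv k).symm.trans hk)
  obtain ⟨⟨h1, h2, h3⟩, h4⟩ := pullbackIter_conj hv hs k (one_mem_Summit v)
    ((Summit.mul_left_iff hcomm).mpr hvs)
  simp only [inv_one, one_mul, mul_one] at h1 h2 h3 h4
  refine ⟨⟨h1, h2, ?_⟩, fun β hβ hβS hβs => h4 β hβ hβS ?_⟩
  · rwa [transportIter_eq hv h2, ← pre_mul_left_iff_inv]
  · rwa [transportIter_eq hv hβS, ← pre_mul_left_iff_inv] at hβs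

end

/-! ### Transport along a whole sliding circuit -/

variable (gs) in
/-- For `v` with `𝔰^N(v) = v`, the `N`-fold transport at `v`, extended to all of `G`. -/
noncomputable def circuitTransport (v : G) (N : ℕ) (β : G) : G :=
  ((gs.summitSliding v)^[N] 1)⁻¹ * (gs.summitSliding v)^[N] β

theorem isEquivariant_circuitTransport {N : ℕ} (hc : Commute ((gs.summitSliding v)^[N] 1) v) :
    gs.IsEquivariant v ((gs.summitSliding v)^[N] 1) (gs.circuitTransport v N) :=
  ((isEquivariant_summitSliding hc).iterate N).inv_mul hc

theorem circuitTransport_one (v : G) (N : ℕ) : gs.circuitTransport v N 1 = 1 :=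
  inv_mul_cancel _

theorem iterate_summitSliding_eq {N : ℕ} (hc : Commute ((gs.summitSliding v)^[N] 1) v) (m : ℕ)
    (β : G) : (gs.summitSliding v)^[m * N] β =
      ((gs.summitSliding v)^[N] 1) ^ m * (gs.circuitTransport v N)^[m] β := by
  induction m generalizing β with
  | zero => simp
  | succ m ih =>
    rw [add_mul, one_mul, add_comm, Function.iterate_add_apply, ih,
      ((isEquivariant_summitSliding hc).iterate N).map_pow_mul_left', pow_succ, mul_assoc,
      Function.iterate_succ_apply', circuitTransport, mul_inv_cancel_left]

theorem iterate_summitSliding_one {N : ℕ} (hc : Commute ((gs.summitSliding v)^[N] 1) v) (m : ℕ) :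
    (gs.summitSliding v)^[m * N] 1 = ((gs.summitSliding v)^[N] 1) ^ m := by
  rw [iterate_summitSliding_eq hc, Function.iterate_fixed (circuitTransport_one v N), mul_one]

theorem transportIter_mul_eq [Nontrivial G] {x : G} (hv : v ∈ gs.SSS x) {N : ℕ}
    (hc : Commute ((gs.summitSliding v)^[N] 1) v) {β : G} (hβ : gs.Summit v β) (m : ℕ) :
    gs.transportIter v β (m * N) = (gs.circuitTransport v N)^[m] β := by
  rw [transportIter_eq hv hβ, iterate_summitSliding_one hc, iterate_summitSliding_eq hc,
    inv_mul_cancel_left]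

theorem Summit.iterate_circuitTransport {N : ℕ} (hc : Commute ((gs.summitSliding v)^[N] 1) v)
    {β : G} (hβ : gs.Summit v β) (m : ℕ) : gs.Summit v ((gs.circuitTransport v N)^[m] β) :=
  hβ.map ((isEquivariant_circuitTransport hc).iterate m)

theorem pre_one_iterate_circuitTransport {N : ℕ}
    (hc : Commute ((gs.summitSliding v)^[N] 1) v) {β : G} (hβ : gs.pre 1 β) (m : ℕ) :
    gs.pre 1 ((gs.circuitTransport v N)^[m] β) := by
  have := ((isEquivariant_circuitTransport hc).iterate m).mono hβ
  rwa [Function.iterate_fixed (circuitTransport_one v N)] at this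

/-- Conjugators fixed by an iterated circuit transport lead to sliding circuits. -/
theorem conj_mem_SC_of_iterate_circuitTransport_eq [Nontrivial G] {x : G} (hv : v ∈ gs.SSS x)
    {N : ℕ} (hN : 0 < N) (hc : Commute ((gs.summitSliding v)^[N] 1) v) {β : G}
    (hβ : gs.Summit v β) {d : ℕ} (hd : 0 < d) (h : (gs.circuitTransport v N)^[d] β = β) :
    β⁻¹ * v * β ∈ gs.SC x := by
  refine ⟨((conj_mem_SSS_iff_mem_Summit hv).mpr hβ).1, d * N, Nat.mul_pos hd hN, ?_⟩
  rw [iterate_sl_conj hv hβ, iterate_summitSliding_eq hc, h, mul_inv_rev]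
  have := (hc.pow_left d).eq
  simp only [mul_assoc]
  rw [← mul_assoc v, ← this, mul_assoc, inv_mul_cancel_left]

/-- Positive conjugators leading to sliding circuits are fixed by an iterated circuit
transport. -/
theorem exists_iterate_circuitTransport_eq [Nontrivial G] {x : G} (hv : v ∈ gs.SSS x) {N : ℕ}
    (hc : Commute ((gs.summitSliding v)^[N] 1) v) {β : G} (hβ : gs.pre 1 β)
    (h : β⁻¹ * v * β ∈ gs.SC x) : ∃ d, 0 < d ∧ (gs.circuitTransport v N)^[d] β = β := by
  have hT := isEquivariant_circuitTransport hc
  have hβS := (conj_mem_SSS_iff_mem_Summit hv).mp (mem_SSS_of_mem_SC h)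
  obtain ⟨-, M, hM, hfix⟩ := h
  set T := gs.circuitTransport v N
  have hfix' : gs.sl^[M * N] (β⁻¹ * v * β) = β⁻¹ * v * β :=
    (congrFun (Function.iterate_mul gs.sl M N) _).trans (Function.iterate_fixed hfix N)
  rw [iterate_sl_conj hv hβS] at hfix'
  obtain ⟨g, hg, hgL⟩ : ∃ g, Commute g v ∧ (gs.summitSliding v)^[M * N] β = g * β := by
    refine ⟨(gs.summitSliding v)^[M * N] β * β⁻¹, commute_of_conj_eq ?_, by simp⟩
    have h3 := congrArg (fun w => β * w * β⁻¹) hfix'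
    simpa [mul_assoc] using h3
  have hgT (k : ℕ) : ((gs.summitSliding v)^[N] 1) ^ (k * M) * T^[k * M] β = g ^ k * β := by
    rw [← iterate_summitSliding_eq hc, mul_assoc]
    induction k with
    | zero => simp
    | succ k ih =>
      rw [add_mul, one_mul, add_comm, Function.iterate_add_apply, ih,
        ((isEquivariant_summitSliding hg).iterate _).map_pow_mul_left', hgL, pow_succ, mul_assoc]
  obtain ⟨n, -, hn⟩ := gs.exists_zpow_neg_pre_pre_zpow β
  obtain ⟨k, l, hkl, heq⟩ := exists_lt_eq_of_mem_Icc (gs := gs)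
    (f := fun k => T^[k * M] β) (a := 1) (b := gs.Δ ^ (n : ℤ))
    (fun k => pre_one_iterate_circuitTransport hc hβ _)
    (fun k => by
      have h1 := (hT.iterate (k * M)).mono hn
      have h2 := (hT.iterate (k * M)).map_mul_zpow n 1
      rw [one_mul, Function.iterate_fixed (circuitTransport_one v N), one_mul] at h2
      rwa [h2] at h1)
  obtain ⟨m, rfl⟩ := Nat.exists_eq_add_of_le hkl.le
  have hm : 0 < m := by lia
  refine ⟨m * M, Nat.mul_pos hm hM, ?_⟩
  have hk := hgT k
  have hl := hgT (k + m)
  rw [← heq, add_mul, add_comm, pow_add, mul_assoc, hk, add_comm, pow_add, ← mul_assoc,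
    mul_left_inj, mul_left_inj] at hl
  have := hgT m
  rw [← hl] at this
  exact mul_left_cancel this

end GarsideStructure

/-- Once the iterated `N`-fold pullbacks of `s` at `v` repeat, say
`s_{(iN)} = s_{(jN)}` with `j > i`, the element `c_s(v)` is the unique element of
`F(s_{(iN)})` admitting `s` as a prefix; in particular `F(s_{(iN)}) ≠ {1}`. -/
theorem pullback_gives_minimal_conjugator (gs : GarsideStructure G) (x v s c : G)
    (hv : v ∈ gs.SC x)
    (N : ℕ) (hN : 0 < N) (hNv : (gs.sl)^[N] v = v)
    (hNmin : ∀ m : ℕ, 0 < m → (gs.sl)^[m] v = v → N ≤ m)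
    (hs : s ∈ gs.P) (hs1 : s ≠ 1) (hvs : s⁻¹ * v * s ∈ gs.SSS x)
    (hc : gs.IsMinSCConj x v s c)
    (i j : ℕ) (hij : i < j)
    (hrep : gs.pullbackIter x v (i * N) s = gs.pullbackIter x v (j * N) s)
    (p : G) (hp : p = gs.pullbackIter x v (i * N) s)
    (i₁ i₂ : ℕ) (h12 : i₁ < i₂)
    (heq : gs.transportIter v p (i₁ * N) = gs.transportIter v p (i₂ * N))
    (hmin₁ : ∀ j₁ j₂ : ℕ, j₁ < j₂ →
      gs.transportIter v p (j₁ * N) = gs.transportIter v p (j₂ * N) → i₁ ≤ j₁)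
    (hmin₂ : ∀ j₂ : ℕ, i₁ < j₂ →
      gs.transportIter v p (i₁ * N) = gs.transportIter v p (j₂ * N) → i₂ ≤ j₂)
    (F : Set G)
    (hF : F = {w : G | ∃ m : ℕ, i₁ ≤ m ∧ m < i₂ ∧ w = gs.transportIter v p (m * N)}) :
    (c ∈ F ∧ gs.pre s c ∧ ∀ w ∈ F, gs.pre s w → w = c) ∧ F ≠ {1} := by
  have : Nontrivial G := ⟨⟨s, 1, hs1⟩⟩
  have hvS := mem_SSS_of_mem_SC hv
  have hcomm : Commute ((gs.summitSliding v)^[N] 1) v :=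
    commute_of_conj_eq ((iterate_sl hvS N).symm.trans hNv)
  have hTe := isEquivariant_circuitTransport hcomm
  have hsS := (conj_mem_SSS_iff_mem_Summit hvS).mp hvs
  have hT {β : G} (hβ : gs.Summit v β) (m : ℕ) := transportIter_mul_eq hvS hcomm hβ m
  have hTS {β : G} (hβ : gs.Summit v β) (m : ℕ) := hβ.iterate_circuitTransport hcomm m
  have hTpos {β : G} (hβ : gs.pre 1 β) (m : ℕ) := pre_one_iterate_circuitTransport hcomm hβ m
  set T := gs.circuitTransport v N
  set P : ℕ → G := fun k => gs.pullbackIter x v (k * N) s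
  -- each iterated pullback is a least element
  have hP (k : ℕ) : (gs.pre 1 (P k) ∧ gs.Summit v (P k) ∧ gs.pre s (T^[k] (P k))) ∧
      ∀ β, gs.pre 1 β → gs.Summit v β → gs.pre s (T^[k] β) → gs.pre (P k) β := by
    have hk : gs.sl^[k * N] v = v := by
      rw [mul_comm, Function.iterate_mul]
      exact Function.iterate_fixed hNv k
    obtain ⟨⟨h1, h2, h3⟩, h4⟩ := pullbackIter_isLeast hvS hs hsS hk
    exact ⟨⟨h1, h2, hT h2 k ▸ h3⟩, fun β hβ hβS h => h4 β hβ hβS (by rwa [hT hβS])⟩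
  have hPiff (k n : ℕ) {β : G} (hβ : gs.pre 1 β) (hβS : gs.Summit v β) :
      gs.pre s (T^[k + n] β) ↔ gs.pre (P k) (T^[n] β) := by
    rw [Function.iterate_add_apply]
    exact ⟨(hP k).2 _ (hTpos hβ n) (hTS hβS n),
      fun h => (hP k).1.2.2.trans ((hTe.iterate k).mono h)⟩
  have hPadd {k l : ℕ} (h : P k = P l) (n : ℕ) : P (k + n) = P (l + n) := by
    refine pre.antisymm (gs := gs) ?_ ?_
    · refine (hP _).2 _ (hP _).1.1 (hP _).1.2.1 ?_
      rw [hPiff k n (hP _).1.1 (hP _).1.2.1, h, ← hPiff l n (hP _).1.1 (hP _).1.2.1]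
      exact (hP _).1.2.2
    · refine (hP _).2 _ (hP _).1.1 (hP _).1.2.1 ?_
      rw [hPiff l n (hP _).1.1 (hP _).1.2.1, ← h, ← hPiff k n (hP _).1.1 (hP _).1.2.1]
      exact (hP _).1.2.2
  obtain ⟨e, rfl⟩ := Nat.exists_eq_add_of_le hij.le
  have he : 0 < e := by lia
  have hPper (t : ℕ) : P (i + t * e) = p := by
    induction t with
    | zero => simpa using hp.symm
    | succ t ih =>
      rw [← ih, show i + (t + 1) * e = i + e + t * e by ring]
      exact (hPadd hrep (t * e)).symm
  have hpi : p = P i := hp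
  have hp1 : gs.pre 1 p := hpi ▸ (hP i).1.1
  have hpS : gs.Summit v p := hpi ▸ (hP i).1.2.1
  obtain ⟨d, rfl⟩ := Nat.exists_eq_add_of_le h12.le
  have hd : 0 < d := by lia
  have hpT : T^[i₁ + d] p = T^[i₁] p := by rw [← hT hpS, ← hT hpS, heq]
  have hfixT {m : ℕ} (hm : i₁ ≤ m) : T^[d] (T^[m] p) = T^[m] p := by
    obtain ⟨m, rfl⟩ := Nat.exists_eq_add_of_le hm
    rw [← Function.iterate_add_apply, show d + (i₁ + m) = m + (i₁ + d) by ring,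
      Function.iterate_add_apply, hpT, ← Function.iterate_add_apply, add_comm]
  have hfixT' {m : ℕ} (hm : i₁ ≤ m) (k : ℕ) : T^[m + k * d] p = T^[m] p := by
    rw [add_comm, Function.iterate_add_apply, mul_comm, Function.iterate_mul]
    exact Function.iterate_fixed (hfixT hm) k
  have hFT {m : ℕ} (hm : i₁ ≤ m) : T^[m] p ∈ F := by
    rw [hF]
    refine ⟨i₁ + (m - i₁) % d, by lia, by have := Nat.mod_lt (m - i₁) hd; lia, ?_⟩
    have hmod : m = i₁ + (m - i₁) % d + (m - i₁) / d * d := by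
      have := Nat.mod_add_div' (m - i₁) d
      lia
    rw [hT hpS]
    exact (congrArg (fun n => T^[n] p) hmod).trans (hfixT' (by lia) _)
  obtain ⟨hsc, hcSC, hcmin⟩ := hc
  have hle {m : ℕ} (hm : i₁ ≤ m) (h : gs.pre s (T^[m] p)) : gs.pre c (T^[m] p) :=
    hcmin _ h
      (conj_mem_SC_of_iterate_circuitTransport_eq hvS hN hcomm (hTS hpS m) hd (hfixT hm))
  have hc1 : gs.pre 1 c := (pre_one_iff.mpr hs).trans hsc
  have hcS := (conj_mem_SSS_iff_mem_Summit hvS).mp (mem_SSS_of_mem_SC hcSC)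
  obtain ⟨b, hb, hcb⟩ := exists_iterate_circuitTransport_eq hvS hcomm hc1 hcSC
  obtain ⟨m, hm, hmc⟩ : ∃ m, i₁ ≤ m ∧ T^[m] p = c := by
    set k := i + i₁ * e with hk
    have hik : i₁ ≤ k := (Nat.le_mul_of_pos_right i₁ he).trans (Nat.le_add_left _ _)
    have hPk : P k = p := hPper i₁
    have hck : T^[k] (T^[k * (b - 1)] c) = c := by
      obtain ⟨b, rfl⟩ : ∃ b', b = b' + 1 := ⟨b - 1, by lia⟩
      rw [← Function.iterate_add_apply, Nat.add_sub_cancel, show k + k * b = (b + 1) * k by ring,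
        Function.iterate_mul]
      exact Function.iterate_fixed hcb k
    have hpc : gs.pre p (T^[k * (b - 1)] c) := by
      rw [← hPk]
      exact (hP k).2 _ (hTpos hc1 _) (hTS hcS _) (by rwa [hck])
    refine ⟨k, hik, pre.antisymm (gs := gs) ?_ (hle hik ?_)⟩
    · have := (hTe.iterate k).mono hpc
      rwa [hck] at this
    · have := (hP k).1.2.2
      rwa [hPk] at this
  have hcF : c ∈ F := hmc ▸ hFT hm
  refine ⟨⟨hcF, hsc, ?_⟩, ?_⟩
  · intro w hw hsw
    rw [hF] at hw
    obtain ⟨l, hl, -, rfl⟩ := hw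
    rw [hT hpS] at hsw ⊢
    have hcl := hle hl hsw
    -- the elements of `F` form one cycle, so that `T^[l] p` is an iterate of `c`
    obtain ⟨r, hr⟩ : ∃ r, T^[r] c = T^[l] p := by
      refine ⟨l + m * d - m, ?_⟩
      have hmd : m ≤ m * d := Nat.le_mul_of_pos_right m hd
      rw [← hmc, ← Function.iterate_add_apply, show l + m * d - m + m = l + m * d by lia,
        hfixT' hl]
    rw [← hr] at hcl ⊢
    have hstep (n : ℕ) : gs.pre (T^[r * n] c) (T^[r * (n + 1)] c) := by
      rw [mul_add, mul_one, Function.iterate_add_apply]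
      exact (hTe.iterate _).mono hcl
    have hrd : T^[r * d] c = c := by
      rw [mul_comm, Function.iterate_mul]
      refine Function.iterate_fixed ?_ r
      rw [← hmc]
      exact hfixT hm
    have := pre_of_le_of_step (f := fun n => T^[r * n] c) hstep (m := 1) (n := d) hd
    rw [hrd, mul_one] at this
    exact this.antisymm hcl
  · intro hF1
    rw [hF1, Set.mem_singleton_iff] at hcF
    rw [hcF] at hsc
    exact hs1 (hsc.antisymm (pre_one_iff.mpr hs))
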